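/- arXiv:2009.12160 — 2 statements merged into one kernel-verified Lean document; each statement's English description precedes it below -/
import Mathlib

section
/- First variation formula for the higher-order contact action: Let L be a Lagrangian of order k, z₀ ∈ ℝ, and let C : (−δ,δ) × [0,1] → ℝⁿ and Z : (−δ,δ) × [0,1] → ℝ be smooth with ∂_t Z(λ,t) = L(C(λ,t), ∂_t C(λ,t), …, ∂_t^k C(λ,t), Z(λ,t)) and Z(λ,0) = z₀ for each λ. Write c = C(0,·), δc(t) = ∂_λ C(0,t), and assume δc⁽ʲ⁾(0) = δc⁽ʲ⁾(1) = 0 for 0 ≤ j < k. Set σ(t) = exp(−∫₀ᵗ (∂L/∂z)(c̄ᵏ(τ), Z(0,τ)) dτ). Then d/dλ Z(λ,1)|_{λ=0} = σ(1)⁻¹ ∫₀¹ Σ_{i=1}^{n} Σ_{α=0}^{k} (−1)^α (d^α/dτ^α)( σ(τ) (∂L/∂q_α^i)(c̄ᵏ(τ), Z(0,τ)) ) · δcⁱ(τ) dτ. -/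
open scoped BigOperators

noncomputable section

namespace HOC

/-- Infinite-jet coordinates `(q_α)_{α ∈ ℕ}` with each `q_α ∈ ℝⁿ`. -/
abbrev Jet (n : ℕ) := ℕ → Fin n → ℝ

/-- Partial derivative of a jet function with respect to the coordinate `q_α^i`. -/
def pq {n : ℕ} (F : Jet n → ℝ → ℝ) (α : ℕ) (i : Fin n) (q : Jet n) (z : ℝ) : ℝ :=
  deriv (fun s : ℝ => F (Function.update q α (Function.update (q α) i s)) z) (q α i)

/-- Partial derivative of a jet function with respect to `z`. -/
def pz {n : ℕ} (F : Jet n → ℝ → ℝ) (q : Jet n) (z : ℝ) : ℝ :=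
  deriv (fun w => F q w) z

/-- Extension of a function of `(q₀,…,q_k,z)` to the jet space, ignoring higher coordinates. -/
def ext {n : ℕ} (k : ℕ) (L : (Fin (k+1) → Fin n → ℝ) → ℝ → ℝ) : Jet n → ℝ → ℝ :=
  fun q z => L (fun α => q α.val) z

/-- The Lagrangian total derivative `D_L` acting on functions of `(q₀,…,q_r,z)`. -/
def DL {n : ℕ} (Lx : Jet n → ℝ → ℝ) (r : ℕ) (F : Jet n → ℝ → ℝ) : Jet n → ℝ → ℝ :=
  fun q z =>
    (∑ α ∈ Finset.range (r+1), ∑ i : Fin n, q (α+1) i * pq F α i q z)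
      + Lx q z * pz F q z - pz Lx q z * F q z

/-- Iterated Lagrangian total derivative `D_L^α`, applied to a function of order `r`. -/
def DLpow {n : ℕ} (Lx : Jet n → ℝ → ℝ) (r : ℕ) : ℕ → (Jet n → ℝ → ℝ) → (Jet n → ℝ → ℝ)
  | 0, F => F
  | (α+1), F => DL Lx (r + α) (DLpow Lx r α F)

/-- The infinite jet lift of a curve `c : ℝ → ℝⁿ`. -/
def lift {n : ℕ} (c : ℝ → Fin n → ℝ) (t : ℝ) : Jet n :=
  fun α => iteratedDeriv α c t

/-- The `k`-jet lift `c̄ᵏ(t) = (c(t), c'(t), …, c⁽ᵏ⁾(t))`. -/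
def jetk {n : ℕ} (k : ℕ) (c : ℝ → Fin n → ℝ) (t : ℝ) : Fin (k+1) → Fin n → ℝ :=
  fun α => iteratedDeriv α.val c t

/-- Smoothness of a Lagrangian of order `k`. -/
def SmoothL {n k : ℕ} (L : (Fin (k+1) → Fin n → ℝ) → ℝ → ℝ) : Prop :=
  ContDiff ℝ (⊤ : ℕ∞) (fun p : (Fin (k+1) → Fin n → ℝ) × ℝ => L p.1 p.2)

/-- The Jacobi–Ostrogradskii momentum `p̂^{r-1}_i = ∑_{α=0}^{k-r} (-1)^α D_L^α (∂L/∂q_{r+α}^i)`. -/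
def momentum {n : ℕ} (k : ℕ) (L : (Fin (k+1) → Fin n → ℝ) → ℝ → ℝ) (r : ℕ) (i : Fin n) :
    Jet n → ℝ → ℝ :=
  fun q z => ∑ α ∈ Finset.range (k - r + 1),
    (-1:ℝ)^α * DLpow (ext k L) k α (pq (ext k L) (r + α) i) q z

/-- The `2k`-th order Herglotz (contact Euler–Lagrange) equations for the pair `(c, z)`. -/
def HerglotzEqs {n : ℕ} (k : ℕ) (L : (Fin (k+1) → Fin n → ℝ) → ℝ → ℝ)
    (c : ℝ → Fin n → ℝ) (z : ℝ → ℝ) : Prop :=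
  ∀ (t : ℝ) (i : Fin n),
    ∑ α ∈ Finset.range (k+1),
      (-1:ℝ)^α * DLpow (ext k L) k α (pq (ext k L) α i) (lift c t) (z t) = 0

/-- The Herglotz ODE `z'(t) = L(c̄ᵏ(t), z(t))`. -/
def HerglotzODE {n : ℕ} (k : ℕ) (L : (Fin (k+1) → Fin n → ℝ) → ℝ → ℝ)
    (c : ℝ → Fin n → ℝ) (z : ℝ → ℝ) : Prop :=
  ∀ t : ℝ, HasDerivAt z (L (jetk k c t) (z t)) t

/-- The Lagrangian energy `E_L = ∑_{r=1}^{k} ∑_i p̂^{r-1}_i q_r^i - L`. -/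
def energy {n : ℕ} (k : ℕ) (L : (Fin (k+1) → Fin n → ℝ) → ℝ → ℝ) : Jet n → ℝ → ℝ :=
  fun q z =>
    (∑ r ∈ Finset.range k, ∑ i : Fin n, momentum k L (r+1) i q z * q (r+1) i) - ext k L q z

/-- Padding a finite collection of coordinates by zero to an infinite jet. -/
def padJet {n : ℕ} (m : ℕ) (q : Fin m → Fin n → ℝ) : Jet n :=
  fun α => if h : α < m then q ⟨α, h⟩ else 0

/-- The generalized Legendre map in coordinates:
`Leg (q₀,…,q_{2k-1}, z) = (q₀,…,q_{k-1}, p̂⁰,…,p̂^{k-1}, z)`. -/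
def Leg {n : ℕ} (k : ℕ) (L : (Fin (k+1) → Fin n → ℝ) → ℝ → ℝ) :
    ((Fin (2*k) → Fin n → ℝ) × ℝ) → ((Fin (2*k) → Fin n → ℝ) × ℝ) :=
  fun w =>
    (fun β i => if (β : ℕ) < k then w.1 β i
      else momentum k L ((β : ℕ) - k + 1) i (padJet (2*k) w.1) w.2, w.2)

section Calculus

variable {E : Type*} [NormedAddCommGroup E] [NormedSpace ℝ E]

lemma hasDerivAt_comp_prodMk_left {f : ℝ × ℝ → E} (hf : ContDiff ℝ (⊤ : ℕ∞) f) (l t : ℝ) :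
    HasDerivAt (fun s => f (s, t)) (fderiv ℝ f (l, t) (1, 0)) l :=
  ((hf.differentiable (by simp)) (l, t)).hasFDerivAt.comp_hasDerivAt l
    ((hasDerivAt_id l).prodMk (hasDerivAt_const l t))

lemma hasDerivAt_comp_prodMk_right {f : ℝ × ℝ → E} (hf : ContDiff ℝ (⊤ : ℕ∞) f) (l t : ℝ) :
    HasDerivAt (fun s => f (l, s)) (fderiv ℝ f (l, t) (0, 1)) t :=
  ((hf.differentiable (by simp)) (l, t)).hasFDerivAt.comp_hasDerivAt t
    ((hasDerivAt_const t l).prodMk (hasDerivAt_id t))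

lemma contDiff_fderiv_apply {F : Type*} [NormedAddCommGroup F] [NormedSpace ℝ F] {f : F → E}
    (hf : ContDiff ℝ (⊤ : ℕ∞) f) (v : F) : ContDiff ℝ (⊤ : ℕ∞) (fun p => fderiv ℝ f p v) :=
  (hf.fderiv_right (m := (⊤ : ℕ∞)) (by simp)).clm_apply contDiff_const

lemma fderiv_fderiv_apply_comm {F : Type*} [NormedAddCommGroup F] [NormedSpace ℝ F] {f : F → E}
    (hf : ContDiff ℝ (⊤ : ℕ∞) f) (p v w : F) :
    fderiv ℝ (fun q => fderiv ℝ f q v) p w = fderiv ℝ (fun q => fderiv ℝ f q w) p v := by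
  have hd : DifferentiableAt ℝ (fderiv ℝ f) p :=
    (hf.fderiv_right (m := (⊤ : ℕ∞)) (by simp)).differentiable (by simp) p
  have hsymm : IsSymmSndFDerivAt ℝ f p :=
    hf.contDiffAt.isSymmSndFDerivAt (by
      rw [minSmoothness_of_isRCLikeNormedField]
      exact WithTop.coe_le_coe.2 (le_top : (2 : ℕ∞) ≤ ⊤))
  have key : ∀ u u' : F, fderiv ℝ (fun q => fderiv ℝ f q u) p u'
      = fderiv ℝ (fderiv ℝ f) p u' u := fun u u' => by
    rw [(hd.hasFDerivAt.clm_apply (hasFDerivAt_const u p)).fderiv]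
    simp
  rw [key, key, hsymm.eq]

lemma contDiff_deriv_comp_prodMk_left {f : ℝ × ℝ → E} (hf : ContDiff ℝ (⊤ : ℕ∞) f) (l : ℝ) :
    ContDiff ℝ (⊤ : ℕ∞) (fun t => deriv (fun s => f (s, t)) l) := by
  simp only [(hasDerivAt_comp_prodMk_left hf l _).deriv]
  exact (contDiff_fderiv_apply hf (1, 0)).comp (contDiff_const.prodMk contDiff_id)

/-- Iterated derivatives in the second variable commute with the derivative in the first. -/
lemma hasDerivAt_iteratedDeriv_comp_prodMk (j : ℕ) {f : ℝ × ℝ → E}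
    (hf : ContDiff ℝ (⊤ : ℕ∞) f) (l t : ℝ) :
    HasDerivAt (fun s => iteratedDeriv j (fun τ => f (s, τ)) t)
      (iteratedDeriv j (fun τ => deriv (fun s => f (s, τ)) l) t) l := by
  induction j generalizing f with
  | zero =>
    simpa only [iteratedDeriv_zero] using
      (hasDerivAt_comp_prodMk_left hf l t).differentiableAt.hasDerivAt
  | succ j ih =>
    have h₁ : ∀ s, deriv (fun τ => f (s, τ)) = fun τ => fderiv ℝ f (s, τ) (0, 1) :=
      fun s => funext fun τ => (hasDerivAt_comp_prodMk_right hf s τ).deriv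
    have h₂ : deriv (fun τ => deriv (fun s => f (s, τ)) l)
        = fun τ => deriv (fun s => fderiv ℝ f (s, τ) (0, 1)) l := by
      funext τ
      simp only [(hasDerivAt_comp_prodMk_left hf l _).deriv]
      rw [(hasDerivAt_comp_prodMk_left (contDiff_fderiv_apply hf (0, 1)) l τ).deriv,
        (hasDerivAt_comp_prodMk_right (contDiff_fderiv_apply hf (1, 0)) l τ).deriv,
        fderiv_fderiv_apply_comm hf]
    simp only [iteratedDeriv_succ', h₁, h₂]
    exact ih (contDiff_fderiv_apply hf (0, 1))

lemma contDiff_iteratedDeriv (j : ℕ) {g : ℝ → E} (hg : ContDiff ℝ (⊤ : ℕ∞) g) :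
    ContDiff ℝ (⊤ : ℕ∞) (iteratedDeriv j g) := by
  rw [iteratedDeriv_eq_iterate]
  exact hg.iterate_deriv j

lemma iteratedDeriv_pi_apply {ι : Type*} [Fintype ι] (j : ℕ) {g : ℝ → ι → ℝ}
    (hg : ContDiff ℝ (⊤ : ℕ∞) g) (i : ι) (t : ℝ) :
    iteratedDeriv j (fun s => g s i) t = iteratedDeriv j g t i := by
  induction j generalizing g with
  | zero => simp
  | succ j ih =>
    have h : deriv (fun s => g s i) = fun s => deriv g s i := funext fun s =>
      (hasDerivAt_pi.1 ((hg.differentiable (by simp)) s).hasDerivAt i).deriv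
    rw [iteratedDeriv_succ', iteratedDeriv_succ', h]
    exact ih (contDiff_infty_iff_deriv.1 hg).2

/-- Repeated integration by parts against a function whose lower derivatives vanish at the
endpoints. -/
lemma integral_mul_iteratedDeriv_eq (m : ℕ) {a b : ℝ} {f g : ℝ → ℝ}
    (hf : ContDiff ℝ (⊤ : ℕ∞) f) (hg : ContDiff ℝ (⊤ : ℕ∞) g)
    (h : ∀ j < m, iteratedDeriv j g a = 0 ∧ iteratedDeriv j g b = 0) :
    ∫ x in a..b, f x * iteratedDeriv m g x
      = ∫ x in a..b, (-1 : ℝ) ^ m * iteratedDeriv m f x * g x := by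
  induction m generalizing f with
  | zero => simp
  | succ m ih =>
    have hf' := (contDiff_infty_iff_deriv.1 hf).2
    have hgm := contDiff_iteratedDeriv m hg
    rw [iteratedDeriv_succ, iteratedDeriv_succ',
      intervalIntegral.integral_mul_deriv_eq_deriv_mul
        (fun x _ => ((hf.differentiable (by simp)) x).hasDerivAt)
        (fun x _ => ((hgm.differentiable (by simp)) x).hasDerivAt)
        (hf'.continuous.intervalIntegrable _ _)
        ((contDiff_infty_iff_deriv.1 hgm).2.continuous.intervalIntegrable _ _),
      (h m m.lt_succ_self).1, (h m m.lt_succ_self).2,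
      ih hf' fun j hj => h j (hj.trans m.lt_succ_self), mul_zero, mul_zero, sub_zero, zero_sub,
      ← intervalIntegral.integral_neg]
    congr 1
    funext x
    ring

lemma contDiff_integral {A : ℝ → ℝ} (hA : ContDiff ℝ (⊤ : ℕ∞) A) (a : ℝ) :
    ContDiff ℝ (⊤ : ℕ∞) (fun s => ∫ u in a..s, A u) := by
  have hd := fun s => (hA.continuous.integral_hasStrictDerivAt a s).hasDerivAt
  refine contDiff_infty_iff_deriv.2 ⟨fun s => (hd s).differentiableAt, ?_⟩
  rwa [show deriv (fun s => ∫ u in a..s, A u) = A from funext fun s => (hd s).deriv]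

lemma integral_sum_sum_congr {ι κ : Type*} [Fintype ι] [Fintype κ] {F G : ι → κ → ℝ → ℝ} {a b : ℝ}
    (hF : ∀ i j, Continuous (F i j)) (hG : ∀ i j, Continuous (G i j))
    (h : ∀ i j, ∫ x in a..b, F i j x = ∫ x in a..b, G i j x) :
    ∫ x in a..b, ∑ i, ∑ j, F i j x = ∫ x in a..b, ∑ i, ∑ j, G i j x := by
  simp only [← Fintype.sum_prod_type']
  rw [intervalIntegral.integral_finsetSum fun p _ => (hF p.1 p.2).intervalIntegrable _ _,
    intervalIntegral.integral_finsetSum fun p _ => (hG p.1 p.2).intervalIntegrable _ _]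
  exact Finset.sum_congr rfl fun p _ => h p.1 p.2

/-- Solution of a scalar linear equation with zero initial value by an integrating factor. -/
lemma eq_inv_exp_mul_integral {A B w : ℝ → ℝ} (hA : Continuous A) (hB : Continuous B)
    (hw : ∀ t, HasDerivAt w (B t + A t * w t) t) {a : ℝ} (h0 : w a = 0) (b : ℝ) :
    w b = (Real.exp (-∫ u in a..b, A u))⁻¹ *
      ∫ τ in a..b, Real.exp (-∫ u in a..τ, A u) * B τ := by
  have hI := fun s => (hA.integral_hasStrictDerivAt a s).hasDerivAt
  have hσ := fun s => (hI s).neg.exp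
  have hcont : Continuous (fun s => Real.exp (-∫ u in a..s, A u)) :=
    continuous_iff_continuousAt.2 fun s => (hσ s).continuousAt
  have hprod : ∀ s, HasDerivAt (fun s => Real.exp (-∫ u in a..s, A u) * w s)
      (Real.exp (-∫ u in a..s, A u) * B s) s := fun s => by
    refine ((hσ s).mul (hw s)).congr_deriv ?_
    simp only [Pi.neg_apply]
    ring
  rw [intervalIntegral.integral_eq_sub_of_hasDerivAt (fun s _ => hprod s)
    ((hcont.mul hB).intervalIntegrable _ _), h0, mul_zero, sub_zero, ← mul_assoc,
    inv_mul_cancel₀ (Real.exp_pos _).ne', one_mul]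

end Calculus

section Jets

variable {n k : ℕ} {L : (Fin (k+1) → Fin n → ℝ) → ℝ → ℝ}

lemma pz_ext (hL : SmoothL L) (q : Jet n) (z : ℝ) :
    pz (ext k L) q z =
      fderiv ℝ (fun p : (Fin (k+1) → Fin n → ℝ) × ℝ => L p.1 p.2)
        (fun α => q α.val, z) (0, 1) := by
  have h := ((hL.differentiable (by simp)) (fun α => q α.val, z)).hasFDerivAt.comp_hasDerivAt z
    ((hasDerivAt_const z (fun α : Fin (k+1) => q α.val)).prodMk (hasDerivAt_id z))
  exact h.deriv

lemma pq_ext (hL : SmoothL L) (α : Fin (k+1)) (i : Fin n) (q : Jet n) (z : ℝ) :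
    pq (ext k L) α i q z =
      fderiv ℝ (fun p : (Fin (k+1) → Fin n → ℝ) × ℝ => L p.1 p.2)
        (fun α => q α.val, z) (Pi.single α (Pi.single i 1), 0) := by
  set q' : Fin (k+1) → Fin n → ℝ := fun β => q β.val with hq'
  have hupd : ∀ s, (fun β : Fin (k+1) =>
      Function.update q α (Function.update (q α) i s) β.val)
      = Function.update q' α (Function.update (q' α) i s) := fun s => by
    funext β
    by_cases hβ : β = α
    · subst hβ; simp [hq']
    · have : (β : ℕ) ≠ α := fun e => hβ (Fin.ext e)
      simp [hq', hβ, this]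
  have hcurve : HasDerivAt
      (fun s => (Function.update q' α (Function.update (q' α) i s), z))
      (Pi.single α (Pi.single i (1:ℝ)), (0:ℝ)) (q α i) := by
    refine HasDerivAt.prodMk ?_ (hasDerivAt_const _ _)
    refine ((hasFDerivAt_update q' (q' α)).comp_hasDerivAt_of_eq (q α i)
      (hasDerivAt_update (q' α) i (q α i)) (by simp [hq'])).congr_deriv ?_
    funext β
    by_cases hβ : β = α
    · subst hβ; simp
    · simp [hβ]
  have h := ((hL.differentiable (by simp)) (q', z)).hasFDerivAt.comp_hasDerivAt_of_eq (q α i)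
    hcurve (by simp [hq'])
  refine Eq.trans ?_ h.deriv
  simp only [pq, ext, hupd]
  rfl

/-- The derivative of the Lagrangian in terms of its coordinate partial derivatives. -/
lemma fderiv_lagrangian_apply (hL : SmoothL L) (q : Jet n) (z : ℝ)
    (v : Fin (k+1) → Fin n → ℝ) (w : ℝ) :
    fderiv ℝ (fun p : (Fin (k+1) → Fin n → ℝ) × ℝ => L p.1 p.2) (fun α => q α.val, z) (v, w)
      = (∑ i : Fin n, ∑ α : Fin (k+1), pq (ext k L) α i q z * v α i)
        + pz (ext k L) q z * w := by
  have hv : (v, w) = (∑ i : Fin n, ∑ α : Fin (k+1),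
      v α i • ((Pi.single α (Pi.single i 1), 0) : (Fin (k+1) → Fin n → ℝ) × ℝ))
      + w • ((0, 1) : (Fin (k+1) → Fin n → ℝ) × ℝ) := by
    refine Prod.ext ?_ ?_
    · funext β j
      simp [Prod.fst_sum, Finset.sum_apply, Pi.single_apply]
    · simp [Prod.snd_sum]
  rw [hv]
  simp only [map_add, map_sum, map_smul, pq_ext hL, pz_ext hL, smul_eq_mul]
  simp only [mul_comm]

lemma contDiff_jetk {c : ℝ → Fin n → ℝ} (hc : ContDiff ℝ (⊤ : ℕ∞) c) :
    ContDiff ℝ (⊤ : ℕ∞) (jetk k c) :=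
  contDiff_pi.2 fun α => contDiff_iteratedDeriv α.val hc

lemma contDiff_pz_ext_lift (hL : SmoothL L) {c : ℝ → Fin n → ℝ} {z : ℝ → ℝ}
    (hc : ContDiff ℝ (⊤ : ℕ∞) c) (hz : ContDiff ℝ (⊤ : ℕ∞) z) :
    ContDiff ℝ (⊤ : ℕ∞) (fun s => pz (ext k L) (lift c s) (z s)) := by
  simp only [pz_ext hL]
  exact (contDiff_fderiv_apply hL (0, 1)).comp ((contDiff_jetk hc).prodMk hz)

lemma contDiff_pq_ext_lift (hL : SmoothL L) {c : ℝ → Fin n → ℝ} {z : ℝ → ℝ}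
    (hc : ContDiff ℝ (⊤ : ℕ∞) c) (hz : ContDiff ℝ (⊤ : ℕ∞) z) (α : Fin (k+1)) (i : Fin n) :
    ContDiff ℝ (⊤ : ℕ∞) (fun s => pq (ext k L) α i (lift c s) (z s)) := by
  simp only [pq_ext hL]
  exact (contDiff_fderiv_apply hL _).comp ((contDiff_jetk hc).prodMk hz)

/-- The linearized Herglotz equation satisfied by the variation of the action. -/
lemma hasDerivAt_variation (hL : SmoothL L) {C : ℝ → ℝ → Fin n → ℝ} {Z : ℝ → ℝ → ℝ}
    (hC : ContDiff ℝ (⊤ : ℕ∞) (fun p : ℝ × ℝ => C p.1 p.2))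
    (hZ : ContDiff ℝ (⊤ : ℕ∞) (fun p : ℝ × ℝ => Z p.1 p.2))
    (hode : ∀ lam t : ℝ, HasDerivAt (Z lam) (L (jetk k (C lam) t) (Z lam t)) t) (l t : ℝ) :
    HasDerivAt (fun t => deriv (fun lam => Z lam t) l)
      ((∑ i : Fin n, ∑ α : Fin (k+1), pq (ext k L) α i (lift (C l) t) (Z l t)
          * iteratedDeriv α (fun τ => deriv (fun lam => C lam τ) l i) t)
        + pz (ext k L) (lift (C l) t) (Z l t) * deriv (fun lam => Z lam t) l) t := by
  have hδ : ContDiff ℝ (⊤ : ℕ∞) (fun τ => deriv (fun lam => C lam τ) l) :=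
    contDiff_deriv_comp_prodMk_left hC l
  have hjet : HasDerivAt (fun lam => jetk k (C lam) t)
      (fun α => iteratedDeriv α.val (fun τ => deriv (fun lam => C lam τ) l) t) l :=
    hasDerivAt_pi.2 fun α => hasDerivAt_iteratedDeriv_comp_prodMk α.val hC l t
  have hZl : HasDerivAt (fun lam => Z lam t) (deriv (fun lam => Z lam t) l) l :=
    (hasDerivAt_comp_prodMk_left hZ l t).differentiableAt.hasDerivAt
  have hchain := ((hL.differentiable (by simp))
    (jetk k (C l) t, Z l t)).hasFDerivAt.comp_hasDerivAt l (hjet.prodMk hZl)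
  have hmixed := hasDerivAt_iteratedDeriv_comp_prodMk 1 hZ l t
  simp only [iteratedDeriv_one] at hmixed
  have heq := hmixed.unique
    (hchain.congr_of_eventuallyEq (.of_forall fun lam => (hode lam t).deriv))
  have hdiff := (contDiff_deriv_comp_prodMk_left hZ l).differentiable (by simp) t
  refine hdiff.hasDerivAt.congr_deriv (heq.trans ?_)
  refine (fderiv_lagrangian_apply hL (lift (C l) t) (Z l t) _ _).trans ?_
  simp only [iteratedDeriv_pi_apply _ hδ]

end Jets

/-- First variation formula for the higher-order contact action. -/
theorem first_variation_formula_contact_action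
    {n k : ℕ} (L : (Fin (k+1) → Fin n → ℝ) → ℝ → ℝ) (hL : SmoothL L)
    (z₀ : ℝ) (C : ℝ → ℝ → Fin n → ℝ) (Z : ℝ → ℝ → ℝ)
    (hC : ContDiff ℝ (⊤ : ℕ∞) (fun p : ℝ × ℝ => C p.1 p.2))
    (hZsm : ContDiff ℝ (⊤ : ℕ∞) (fun p : ℝ × ℝ => Z p.1 p.2))
    (hode : ∀ lam t : ℝ, HasDerivAt (Z lam) (L (jetk k (C lam) t) (Z lam t)) t)
    (hinit : ∀ lam : ℝ, Z lam 0 = z₀)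
    (hbd : ∀ j : ℕ, j < k →
      iteratedDeriv j (fun t => deriv (fun lam => C lam t) 0) 0 = 0 ∧
      iteratedDeriv j (fun t => deriv (fun lam => C lam t) 0) 1 = 0) :
    deriv (fun lam => Z lam 1) 0
      = (Real.exp (-∫ u in (0:ℝ)..(1:ℝ), pz (ext k L) (lift (C 0) u) (Z 0 u)))⁻¹ *
        ∫ τ in (0:ℝ)..(1:ℝ), ∑ i : Fin n, ∑ α ∈ Finset.range (k+1),
          (-1:ℝ)^α *
            iteratedDeriv α
              (fun s => Real.exp (-∫ u in (0:ℝ)..s, pz (ext k L) (lift (C 0) u) (Z 0 u)) *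
                pq (ext k L) α i (lift (C 0) s) (Z 0 s)) τ *
            deriv (fun lam => C lam τ) 0 i := by
  have hc : ContDiff ℝ (⊤ : ℕ∞) (C 0) := hC.comp (contDiff_const.prodMk contDiff_id)
  have hz : ContDiff ℝ (⊤ : ℕ∞) (Z 0) := hZsm.comp (contDiff_const.prodMk contDiff_id)
  have hδ : ContDiff ℝ (⊤ : ℕ∞) (fun τ => deriv (fun lam => C lam τ) 0) :=
    contDiff_deriv_comp_prodMk_left hC 0
  have hδi := contDiff_pi.1 hδ
  have hA := contDiff_pz_ext_lift hL hc hz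
  have hb := contDiff_pq_ext_lift hL hc hz
  have hσ : ContDiff ℝ (⊤ : ℕ∞)
      (fun s => Real.exp (-∫ u in (0:ℝ)..s, pz (ext k L) (lift (C 0) u) (Z 0 u))) :=
    (contDiff_integral hA 0).neg.exp
  have hB : Continuous (fun t => ∑ i : Fin n, ∑ α : Fin (k+1),
      pq (ext k L) α i (lift (C 0) t) (Z 0 t)
        * iteratedDeriv α (fun τ => deriv (fun lam => C lam τ) 0 i) t) :=
    continuous_finsetSum _ fun i _ => continuous_finsetSum _ fun α _ =>
      (hb α i).continuous.mul (contDiff_iteratedDeriv _ (hδi i)).continuous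
  rw [eq_inv_exp_mul_integral hA.continuous hB
    (fun t => hasDerivAt_variation hL hC hZsm hode 0 t) (a := 0) (by simp [hinit]) 1]
  congr 1
  simp only [Finset.mul_sum, Finset.sum_range, ← mul_assoc]
  refine integral_sum_sum_congr
    (fun i α => (hσ.mul (hb α i)).continuous.mul (contDiff_iteratedDeriv _ (hδi i)).continuous)
    (fun i α => (continuous_const.mul
      (contDiff_iteratedDeriv _ (hσ.mul (hb α i))).continuous).mul (hδi i).continuous)
    fun i α => integral_mul_iteratedDeriv_eq α (hσ.mul (hb α i)) (hδi i) fun j hj => ?_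
  have hjk := hbd j (lt_of_lt_of_le hj (Nat.lt_succ_iff.1 α.isLt))
  rw [iteratedDeriv_pi_apply j hδ, iteratedDeriv_pi_apply j hδ, hjk.1, hjk.2]
  simp

end HOC
end
end

section
/- Dissipation of the Lagrangian energy along Herglotz solutions: Let L be a Lagrangian of order k and define the Lagrangian energy E_L = Σ_{r=1}^{k} Σ_{i=1}^{n} p̂^{r−1}_i · q_r^i − L on (ℝⁿ)^{2k} × ℝ. If (c, z) is a smooth pair with z′(t) = L(c̄ᵏ(t), z(t)) satisfying the 2k-th order Herglotz equations, then for all t, (d/dt)[E_L(c̄^{2k−1}(t), z(t))] = (∂L/∂z)(c̄ᵏ(t), z(t)) · E_L(c̄^{2k−1}(t), z(t)). -/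
open scoped BigOperators

noncomputable section

namespace HOC

/-- `F` is a smooth function of the coordinates `(q₀,…,q_r,z)` only. -/
def SmoothOfOrder {n : ℕ} (r : ℕ) (F : Jet n → ℝ → ℝ) : Prop :=
  ∃ G : (Fin (r+1) → Fin n → ℝ) × ℝ → ℝ, ContDiff ℝ (⊤ : ℕ∞) G ∧
    ∀ q z, F q z = G (fun α => q α.val, z)

/-- The coordinate vector `∂/∂q_α^i` in the space of `(q₀,…,q_r,z)`; it vanishes if `r < α`. -/
def coordVec {n : ℕ} (r α : ℕ) (i : Fin n) : (Fin (r+1) → Fin n → ℝ) × ℝ :=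
  (fun β => if β.val = α then Pi.single i 1 else 0, 0)

theorem pq_eq_fderiv {n r : ℕ} {F : Jet n → ℝ → ℝ} {G : (Fin (r+1) → Fin n → ℝ) × ℝ → ℝ}
    (hG : Differentiable ℝ G) (hF : ∀ q z, F q z = G (fun α => q α.val, z))
    (α : ℕ) (i : Fin n) (q : Jet n) (z : ℝ) :
    pq F α i q z = fderiv ℝ G (fun α => q α.val, z) (coordVec r α i) := by
  have hγ : HasDerivAt (fun s : ℝ => ((fun β : Fin (r+1) =>
      Function.update q α (Function.update (q α) i s) β.val, z) : (Fin (r+1) → Fin n → ℝ) × ℝ))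
      (coordVec r α i) (q α i) := by
    refine HasDerivAt.prodMk (hasDerivAt_pi.2 fun β => ?_) (hasDerivAt_const _ _)
    by_cases h : β.val = α
    · simpa [h] using hasDerivAt_update (q α) i (q α i)
    · simpa [h] using hasDerivAt_const (q α i) (q β.val)
  have hpt : ((fun β : Fin (r+1) =>
      Function.update q α (Function.update (q α) i (q α i)) β.val, z) :
      (Fin (r+1) → Fin n → ℝ) × ℝ) = (fun α => q α.val, z) := by simp
  have h := HasFDerivAt.comp_hasDerivAt (q α i) (hG _).hasFDerivAt hγ
  rw [hpt] at h
  simp only [pq, hF]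
  exact h.deriv

theorem pz_eq_fderiv {n r : ℕ} {F : Jet n → ℝ → ℝ} {G : (Fin (r+1) → Fin n → ℝ) × ℝ → ℝ}
    (hG : Differentiable ℝ G) (hF : ∀ q z, F q z = G (fun α => q α.val, z))
    (q : Jet n) (z : ℝ) :
    pz F q z = fderiv ℝ G (fun α => q α.val, z) (0, 1) := by
  have hγ : HasDerivAt (fun s : ℝ => ((fun β : Fin (r+1) => q β.val, s) :
      (Fin (r+1) → Fin n → ℝ) × ℝ)) (0, 1) z :=
    HasDerivAt.prodMk (hasDerivAt_const _ _) (hasDerivAt_id _)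
  have h := HasFDerivAt.comp_hasDerivAt z (hG _).hasFDerivAt hγ
  simp only [pz, hF]
  exact h.deriv

namespace SmoothOfOrder

variable {n r : ℕ} {F F' : Jet n → ℝ → ℝ}

theorem mono {m : ℕ} (hF : SmoothOfOrder r F) (h : r ≤ m) : SmoothOfOrder m F := by
  obtain ⟨G, hG, hFG⟩ := hF
  refine ⟨fun p => G (fun α => p.1 (Fin.castLE (by omega) α), p.2), ?_, fun q z => hFG q z⟩
  exact hG.comp (by fun_prop)

theorem pq (hF : SmoothOfOrder r F) (α : ℕ) (i : Fin n) : SmoothOfOrder r (pq F α i) := by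
  obtain ⟨G, hG, hFG⟩ := hF
  refine ⟨fun p => fderiv ℝ G p (coordVec r α i), ?_,
    pq_eq_fderiv (hG.differentiable (by simp)) hFG α i⟩
  exact (hG.fderiv_right (m := (⊤ : ℕ∞)) (by simp)).clm_apply contDiff_const

theorem pz (hF : SmoothOfOrder r F) : SmoothOfOrder r (pz F) := by
  obtain ⟨G, hG, hFG⟩ := hF
  refine ⟨fun p => fderiv ℝ G p (0, 1), ?_, pz_eq_fderiv (hG.differentiable (by simp)) hFG⟩
  exact (hG.fderiv_right (m := (⊤ : ℕ∞)) (by simp)).clm_apply contDiff_const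

theorem mul (hF : SmoothOfOrder r F) (hF' : SmoothOfOrder r F') :
    SmoothOfOrder r (fun q z => F q z * F' q z) := by
  obtain ⟨G, hG, hFG⟩ := hF
  obtain ⟨G', hG', hFG'⟩ := hF'
  exact ⟨fun p => G p * G' p, hG.mul hG', fun q z => by simp only [hFG, hFG']⟩

theorem add (hF : SmoothOfOrder r F) (hF' : SmoothOfOrder r F') :
    SmoothOfOrder r (fun q z => F q z + F' q z) := by
  obtain ⟨G, hG, hFG⟩ := hF
  obtain ⟨G', hG', hFG'⟩ := hF'
  exact ⟨fun p => G p + G' p, hG.add hG', fun q z => by simp only [hFG, hFG']⟩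

theorem sub (hF : SmoothOfOrder r F) (hF' : SmoothOfOrder r F') :
    SmoothOfOrder r (fun q z => F q z - F' q z) := by
  obtain ⟨G, hG, hFG⟩ := hF
  obtain ⟨G', hG', hFG'⟩ := hF'
  exact ⟨fun p => G p - G' p, hG.sub hG', fun q z => by simp only [hFG, hFG']⟩

theorem sum {ι : Type*} {s : Finset ι} {F : ι → Jet n → ℝ → ℝ}
    (hF : ∀ j ∈ s, SmoothOfOrder r (F j)) :
    SmoothOfOrder r (fun q z => ∑ j ∈ s, F j q z) := by
  classical
  induction s using Finset.induction_on with
  | empty => exact ⟨fun _ => 0, contDiff_const, fun q z => by simp⟩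
  | insert a s ha ih =>
    simp only [Finset.sum_insert ha]
    exact (hF a (Finset.mem_insert_self a s)).add
      (ih fun j hj => hF j (Finset.mem_insert_of_mem hj))

theorem coord {α : ℕ} (hα : α ≤ r) (i : Fin n) : SmoothOfOrder r (fun q _ => q α i) :=
  ⟨fun p => p.1 ⟨α, by omega⟩ i, by fun_prop, fun _ _ => rfl⟩

theorem DL {Lx : Jet n → ℝ → ℝ} (hL : SmoothOfOrder r Lx) (hF : SmoothOfOrder r F) :
    SmoothOfOrder (r+1) (DL Lx r F) := by
  have h : r ≤ r + 1 := r.le_succ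
  have hsum : SmoothOfOrder (r+1) (fun q z =>
      ∑ α ∈ Finset.range (r+1), ∑ i : Fin n, q (α+1) i * HOC.pq F α i q z) :=
    sum fun α hα => sum fun i _ =>
      (coord (by simpa using hα) i).mul ((hF.pq α i).mono h)
  exact (hsum.add ((hL.mul hF.pz).mono h)).sub ((hL.pz.mul hF).mono h)

theorem DLpow {Lx : Jet n → ℝ → ℝ} (hL : SmoothOfOrder r Lx) (hF : SmoothOfOrder r F) (α : ℕ) :
    SmoothOfOrder (r + α) (DLpow Lx r α F) := by
  induction α with
  | zero => exact hF
  | succ α ih => exact DL (hL.mono (r.le_add_right α)) ih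

end SmoothOfOrder

theorem eq_sum_coordVec {n r : ℕ} (v : (Fin (r+1) → Fin n → ℝ) × ℝ) :
    v = (∑ α : Fin (r+1), ∑ i : Fin n, v.1 α i • coordVec r α.val i) + v.2 • (0, 1) := by
  refine Prod.ext (funext fun β => funext fun j => ?_) ?_
  · simp [coordVec, Prod.fst_sum, Finset.sum_apply, Fin.val_inj, Pi.single_apply]
  · simp [coordVec, Prod.snd_sum]

theorem hasDerivAt_lift {n : ℕ} {c : ℝ → Fin n → ℝ} (hc : ContDiff ℝ (⊤ : ℕ∞) c) (α : ℕ) (t : ℝ) :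
    HasDerivAt (fun s => lift c s α) (lift c t (α+1)) t := by
  have hd : Differentiable ℝ (iteratedDeriv α c) :=
    hc.differentiable_iteratedDeriv α (by exact_mod_cast WithTop.coe_lt_top α)
  simpa only [lift, iteratedDeriv_succ] using (hd t).hasDerivAt

/-- Along a solution of `z' = L`, the time derivative of `F` is `D_L F + (∂L/∂z) F`. -/
theorem SmoothOfOrder.hasDerivAt {n k r : ℕ} {L : (Fin (k+1) → Fin n → ℝ) → ℝ → ℝ}
    {c : ℝ → Fin n → ℝ} (hc : ContDiff ℝ (⊤ : ℕ∞) c) {z : ℝ → ℝ} (hode : HerglotzODE k L c z)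
    {F : Jet n → ℝ → ℝ} (hF : SmoothOfOrder r F) (t : ℝ) :
    HasDerivAt (fun s => F (lift c s) (z s))
      (HOC.DL (ext k L) r F (lift c t) (z t)
        + HOC.pz (ext k L) (lift c t) (z t) * F (lift c t) (z t)) t := by
  obtain ⟨G, hG, hFG⟩ := hF
  have hGd : Differentiable ℝ G := hG.differentiable (by simp)
  have hγ : HasDerivAt (fun s : ℝ => ((fun β : Fin (r+1) => lift c s β.val, z s) :
      (Fin (r+1) → Fin n → ℝ) × ℝ))
      (fun β : Fin (r+1) => lift c t (β.val+1), ext k L (lift c t) (z t)) t :=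
    HasDerivAt.prodMk (hasDerivAt_pi.2 fun β => hasDerivAt_lift hc β.val t) (hode t)
  have h := HasFDerivAt.comp_hasDerivAt t (hGd _).hasFDerivAt hγ
  have hfun : (fun s => F (lift c s) (z s)) =
      G ∘ fun s : ℝ => (fun β : Fin (r+1) => lift c s β.val, z s) :=
    funext fun s => hFG _ _
  rw [hfun]
  refine h.congr_deriv ?_
  rw [eq_sum_coordVec (fun β : Fin (r+1) => lift c t (β.val+1), ext k L (lift c t) (z t))]
  simp only [map_add, map_sum, map_smul, smul_eq_mul, HOC.DL, Finset.sum_range,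
    pq_eq_fderiv hGd hFG, pz_eq_fderiv hGd hFG]
  ring

section Momentum

variable {n k : ℕ} {L : (Fin (k+1) → Fin n → ℝ) → ℝ → ℝ}

theorem SmoothL.smoothOfOrder (hL : SmoothL L) : SmoothOfOrder k (ext k L) :=
  ⟨fun p => L p.1 p.2, hL, fun _ _ => rfl⟩

theorem momentum_self (i : Fin n) : momentum k L k i = pq (ext k L) k i := by
  funext q z
  simp [momentum, DLpow]

/-- Along a solution of `z' = L`, one has `(p̂ʳ)' = ∂L/∂q_r - p̂^{r-1} + (∂L/∂z) p̂ʳ`. -/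
theorem hasDerivAt_momentum (hL : SmoothL L) {c : ℝ → Fin n → ℝ}
    (hc : ContDiff ℝ (⊤ : ℕ∞) c) {z : ℝ → ℝ} (hode : HerglotzODE k L c z)
    {r : ℕ} (hr : r < k) (i : Fin n) (t : ℝ) :
    HasDerivAt (fun s => momentum k L (r+1) i (lift c s) (z s))
      (pq (ext k L) r i (lift c t) (z t) - momentum k L r i (lift c t) (z t)
        + pz (ext k L) (lift c t) (z t) * momentum k L (r+1) i (lift c t) (z t)) t := by
  have hα (α : ℕ) := ((hL.smoothOfOrder.DLpow
    (hL.smoothOfOrder.pq (r + 1 + α) i) α).hasDerivAt hc hode t).const_mul ((-1:ℝ)^α)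
  refine (HasDerivAt.fun_sum (u := Finset.range (k - (r+1) + 1))
    fun α _ => hα α).congr_deriv ?_
  have hk : k - (r+1) + 1 = k - r := by omega
  simp only [momentum, hk, Finset.sum_range_succ' _ (k - r), Finset.mul_sum]
  rw [add_comm (∑ _ ∈ _, _), sub_add_eq_sub_sub]
  simp only [DLpow, pow_zero, one_mul, add_zero, sub_self, zero_sub, ← Finset.sum_neg_distrib,
    ← Finset.sum_add_distrib]
  refine Finset.sum_congr rfl fun α _ => ?_
  rw [add_right_comm r 1 α, add_assoc r α 1]
  ring

end Momentum

/-- Dissipation of the Lagrangian energy along Herglotz solutions. -/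
theorem energy_dissipation_along_herglotz_solutions
    {n k : ℕ} (L : (Fin (k+1) → Fin n → ℝ) → ℝ → ℝ) (hL : SmoothL L)
    (c : ℝ → Fin n → ℝ) (hc : ContDiff ℝ (⊤ : ℕ∞) c)
    (z : ℝ → ℝ) (hz : ContDiff ℝ (⊤ : ℕ∞) z)
    (hode : HerglotzODE k L c z) (heqs : HerglotzEqs k L c z) :
    ∀ t : ℝ, HasDerivAt (fun s => energy k L (lift c s) (z s))
      (pz (ext k L) (lift c t) (z t) * energy k L (lift c t) (z t)) t := by
  intro t
  have hterm (r : ℕ) (hr : r ∈ Finset.range k) (i : Fin n) :=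
    (hasDerivAt_momentum hL hc hode (Finset.mem_range.1 hr) i t).mul
      (hasDerivAt_pi.1 (hasDerivAt_lift hc (r+1) t) i)
  have hE := (HasDerivAt.fun_sum fun r hr => HasDerivAt.fun_sum (u := Finset.univ)
    fun i _ => hterm r hr i).sub (hL.smoothOfOrder.hasDerivAt hc hode t)
  refine hE.congr_deriv ?_
  have hzero (i : Fin n) : momentum k L 0 i (lift c t) (z t) = 0 := by
    simpa [momentum] using heqs t i
  have htel := Finset.sum_range_sub
    (fun r => ∑ i, momentum k L r i (lift c t) (z t) * lift c t (r+1) i) k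
  simp only [hzero, momentum_self, zero_mul, Finset.sum_const_zero, sub_zero] at htel
  simp only [DL, energy, Finset.sum_range_succ _ k, mul_sub, Finset.mul_sum]
  simp only [mul_comm (lift c t _ _)]
  rw [← htel]
  simp only [add_mul, sub_mul, Finset.sum_add_distrib, Finset.sum_sub_distrib, mul_assoc]
  ring

end HOC
end
end
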